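/- Let X be a finite set of distinct points in ℝⁿ and let Y ⊂ X be a nonempty proper subset, with points indexed so those of Y come first, giving ζ_X = [[ζ_Y, ζ_{Y,Ȳ}], [ζ_{Y,Ȳ}ᵀ, ζ_Ȳ]] where Ȳ = X∖Y. Then both Schur complements ζ_X/ζ_Ȳ = ζ_Y − ζ_{Y,Ȳ}ζ_Ȳ⁻¹ζ_{Y,Ȳ}ᵀ and ζ_X/ζ_Y = ζ_Ȳ − ζ_{Y,Ȳ}ᵀζ_Y⁻¹ζ_{Y,Ȳ} are invertible, and the restrictions of the weighting vector w_X satisfy w_X|_Y = (ζ_X/ζ_Ȳ)⁻¹(𝟙_Y − ζ_{Y,Ȳ}·w_Ȳ) and w_X|_Ȳ = (ζ_X/ζ_Y)⁻¹(𝟙_Ȳ − ζ_{Y,Ȳ}ᵀ·w_Y), where w_Y = ζ_Y⁻¹𝟙_Y and w_Ȳ = ζ_Ȳ⁻¹𝟙_Ȳ. -/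

import Mathlib

open Matrix

/-- Expansion of the quadratic form of the kernel `exp ⟨v, w⟩` over monomials. -/
theorem hasSum_exp_dotProduct_kernel {ι κ : Type*} [Fintype ι] [Fintype κ]
    (v : ι → κ → ℝ) (c : ι → ℝ) :
    HasSum (fun k : ℕ => (∑ a : Fin k → κ, (∑ i, c i * ∏ l, v i (a l)) ^ 2) / k.factorial)
      (∑ i, ∑ j, c i * c j * Real.exp (v i ⬝ᵥ v j)) := by
  have h : HasSum (fun k : ℕ => ∑ i, ∑ j, c i * c j * ((v i ⬝ᵥ v j) ^ k / k.factorial))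
      (∑ i, ∑ j, c i * c j * Real.exp (v i ⬝ᵥ v j)) := by
    refine hasSum_sum fun i _ => hasSum_sum fun j _ => HasSum.mul_left _ ?_
    rw [Real.exp_eq_exp_ℝ]
    exact NormedSpace.expSeries_div_hasSum_exp _
  convert h using 2 with k
  have key : ∀ i j, (v i ⬝ᵥ v j) ^ k = ∑ a : Fin k → κ, (∏ l, v i (a l)) * ∏ l, v j (a l) := by
    intro i j
    simp only [dotProduct, Fintype.sum_pow, Finset.prod_mul_distrib]
  simp only [key, mul_div_assoc', ← Finset.sum_div, Finset.mul_sum]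
  congr 1
  simp only [sq, Finset.sum_mul_sum]
  rw [Finset.sum_comm]
  refine Finset.sum_congr rfl fun i _ => ?_
  rw [Finset.sum_comm]
  refine Finset.sum_congr rfl fun j _ => Finset.sum_congr rfl fun a _ => ?_
  ring

theorem sq_sum_le_exp_dotProduct_kernel {ι κ : Type*} [Fintype ι] [Fintype κ]
    (v : ι → κ → ℝ) (c : ι → ℝ) :
    (∑ i, c i) ^ 2 ≤ ∑ i, ∑ j, c i * c j * Real.exp (v i ⬝ᵥ v j) := by
  have h := le_hasSum (hasSum_exp_dotProduct_kernel v c) 0 fun k _ => by positivity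
  simpa using h

/-- A finitely supported functional on `κ → ℝ` at distinct points that kills every monomial is
zero. -/
theorem eq_zero_of_sum_mul_monomial_eq_zero {ι κ : Type*} [Fintype ι] [Fintype κ]
    {v : ι → κ → ℝ} (hv : Function.Injective v) {c : ι → ℝ}
    (h : ∀ (k : ℕ) (a : Fin k → κ), ∑ i, c i * ∏ l, v i (a l) = 0) : c = 0 := by
  classical
  have hpoly : ∀ (p : MvPolynomial κ ℝ) (k : ℕ) (a : Fin k → κ),
      ∑ i, c i * (MvPolynomial.eval (v i) p * ∏ l, v i (a l)) = 0 := by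
    intro p
    induction p using MvPolynomial.induction_on with
    | C r =>
      intro k a
      simp only [MvPolynomial.eval_C, mul_left_comm _ r, ← Finset.mul_sum, h, mul_zero]
    | add p q hp hq =>
      intro k a
      simp only [map_add, add_mul, mul_add, Finset.sum_add_distrib, hp, hq, add_zero]
    | mul_X p n hp =>
      intro k a
      simpa [Fin.prod_univ_succ, mul_assoc] using hp (k + 1) (Fin.cons n a)
  funext m
  let P : MvPolynomial κ ℝ := ∏ j ∈ Finset.univ.erase m,
    ∑ t, (MvPolynomial.X t - MvPolynomial.C (v j t)) ^ 2
  have hP : ∀ i, MvPolynomial.eval (v i) P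
      = ∏ j ∈ Finset.univ.erase m, ∑ t, (v i t - v j t) ^ 2 := by
    intro i
    simp [P, map_prod]
  have hsum := hpoly P 0 Fin.elim0
  rw [Finset.sum_eq_single m] at hsum
  · refine (mul_eq_zero.mp hsum).resolve_right ?_
    simp only [Finset.univ_eq_empty, Finset.prod_empty, mul_one, hP]
    refine Finset.prod_ne_zero_iff.mpr fun j hj h0 => Finset.ne_of_mem_erase hj (hv ?_)
    funext t
    have := (Finset.sum_eq_zero_iff_of_nonneg fun t _ => sq_nonneg _).mp h0 t (Finset.mem_univ t)
    exact (sub_eq_zero.mp (pow_eq_zero_iff two_ne_zero |>.mp this)).symm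
  · intro i _ hi
    rw [hP, Finset.prod_eq_zero (Finset.mem_erase.mpr ⟨hi, Finset.mem_univ i⟩)] <;> simp
  · simp

theorem exp_dotProduct_kernel_pos {ι κ : Type*} [Fintype ι] [Fintype κ]
    {v : ι → κ → ℝ} (hv : Function.Injective v) {c : ι → ℝ} (hc : c ≠ 0) :
    0 < ∑ i, ∑ j, c i * c j * Real.exp (v i ⬝ᵥ v j) := by
  have hs := hasSum_exp_dotProduct_kernel v c
  have hnn : ∀ k : ℕ,
      0 ≤ (∑ a : Fin k → κ, (∑ i, c i * ∏ l, v i (a l)) ^ 2) / (k.factorial : ℝ) :=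
    fun k => by positivity
  refine (hs.nonneg hnn).lt_of_ne fun h0 => hc ?_
  rw [← h0, hasSum_zero_iff_of_nonneg hnn] at hs
  refine eq_zero_of_sum_mul_monomial_eq_zero hv fun k a => ?_
  have hk := (div_eq_zero_iff.mp (congrFun hs k)).resolve_right (by positivity)
  exact pow_eq_zero_iff two_ne_zero |>.mp
    ((Finset.sum_eq_zero_iff_of_nonneg fun a _ => sq_nonneg _).mp hk a (Finset.mem_univ a))

theorem integrable_one_sub_exp_neg_sq_div_sq :
    MeasureTheory.Integrable fun u : ℝ => (1 - Real.exp (-u ^ 2)) / u ^ 2 := by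
  refine (integrable_inv_one_add_sq.const_mul 2).mono'
    (by fun_prop : Measurable _).aestronglyMeasurable (Filter.Eventually.of_forall fun u => ?_)
  have h1 : Real.exp (-u ^ 2) ≤ 1 := Real.exp_le_one_iff.mpr (by nlinarith [sq_nonneg u])
  have h2 := Real.add_one_le_exp (-u ^ 2)
  have h3 := Real.exp_pos (-u ^ 2)
  rw [Real.norm_of_nonneg (div_nonneg (by linarith) (sq_nonneg u))]
  rcases eq_or_ne u 0 with rfl | hu
  · simp
  · have : 0 < u ^ 2 := by positivity
    rw [← div_eq_mul_inv, div_le_div_iff₀ this (by positivity)]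
    nlinarith

theorem integral_one_sub_exp_neg_sq_div_sq_pos :
    0 < ∫ u : ℝ, (1 - Real.exp (-u ^ 2)) / u ^ 2 := by
  rw [MeasureTheory.integral_pos_iff_support_of_nonneg _ integrable_one_sub_exp_neg_sq_div_sq]
  · refine lt_of_lt_of_le (b := MeasureTheory.volume (Set.Ioo (0 : ℝ) 1)) (by simp)
      (MeasureTheory.measure_mono fun u hu => ?_)
    have hu2 : 0 < u ^ 2 := pow_pos hu.1 2
    have : Real.exp (-u ^ 2) < 1 := by simpa using Real.exp_lt_exp.mpr (neg_lt_zero.mpr hu2)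
    exact (div_pos (by linarith) hu2).ne'
  · intro u
    have h1 : Real.exp (-u ^ 2) ≤ 1 := Real.exp_le_one_iff.mpr (by nlinarith [sq_nonneg u])
    exact div_nonneg (by linarith) (sq_nonneg u)

theorem one_sub_exp_neg_mul_sq_div_sq (r u : ℝ) :
    (1 - Real.exp (-(r * u) ^ 2)) / u ^ 2
      = r ^ 2 * ((1 - Real.exp (-(r * u) ^ 2)) / (r * u) ^ 2) := by
  rcases eq_or_ne r 0 with rfl | hr
  · simp
  · rcases eq_or_ne u 0 with rfl | hu
    · simp
    · field_simp

theorem integrable_one_sub_exp_neg_mul_sq_div_sq (r : ℝ) :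
    MeasureTheory.Integrable fun u : ℝ => (1 - Real.exp (-(r * u) ^ 2)) / u ^ 2 := by
  simp only [one_sub_exp_neg_mul_sq_div_sq r]
  rcases eq_or_ne r 0 with rfl | hr
  · simp
  · exact (integrable_one_sub_exp_neg_sq_div_sq.comp_mul_left' hr).const_mul _

theorem integral_one_sub_exp_neg_mul_sq_div_sq {r : ℝ} (hr : 0 ≤ r) :
    ∫ u : ℝ, (1 - Real.exp (-(r * u) ^ 2)) / u ^ 2
      = r * ∫ u : ℝ, (1 - Real.exp (-u ^ 2)) / u ^ 2 := by
  simp only [one_sub_exp_neg_mul_sq_div_sq r]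
  rw [MeasureTheory.integral_const_mul,
    MeasureTheory.Measure.integral_comp_mul_left (fun u : ℝ => (1 - Real.exp (-u ^ 2)) / u ^ 2) r,
    smul_eq_mul, abs_of_nonneg (inv_nonneg.mpr hr), ← mul_assoc]
  congr 1
  rcases eq_or_ne r 0 with rfl | hr0
  · simp
  · field_simp

section ExpDist

variable {ι κ : Type*} [Fintype ι] [Fintype κ]

/-- The Gaussian kernel, recentred at the origin, is positive semidefinite. -/
theorem recentred_gaussian_kernel_nonneg
    (x : ι → EuclideanSpace ℝ κ) (c : ι → ℝ) (u : ℝ) :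
    0 ≤ ∑ i, ∑ j, c i * c j * ((1 - Real.exp (-(‖x i‖ * u) ^ 2))
      + (1 - Real.exp (-(‖x j‖ * u) ^ 2)) - (1 - Real.exp (-(dist (x i) (x j) * u) ^ 2))) := by
  let g : ι → ℝ := fun i => Real.exp (-(‖x i‖ * u) ^ 2)
  let v : ι → κ → ℝ := fun i t => √2 * u * x i t
  have hG : ∀ i j, Real.exp (-(dist (x i) (x j) * u) ^ 2)
      = g i * g j * Real.exp (v i ⬝ᵥ v j) := by
    intro i j
    have hv : v i ⬝ᵥ v j = 2 * u ^ 2 * inner ℝ (x i) (x j) := by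
      simp only [v, dotProduct, PiLp.inner_apply, Finset.mul_sum]
      refine Finset.sum_congr rfl fun t _ => ?_
      have := Real.mul_self_sqrt (zero_le_two : (0 : ℝ) ≤ 2)
      simp only [RCLike.inner_apply, conj_trivial]
      linear_combination (u ^ 2 * x i t * x j t) * this
    simp only [g]
    rw [hv, ← Real.exp_add, ← Real.exp_add, dist_eq_norm, mul_pow, norm_sub_sq_real]
    congr 1
    ring
  have h := sq_sum_le_exp_dotProduct_kernel v fun i => c i * g i
  have hexp : ∑ i, ∑ j, c i * c j * ((1 - g i) + (1 - g j) - (1 - g i * g j * Real.exp (v i ⬝ᵥ v j)))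
      = (∑ i, c i) ^ 2 - 2 * ((∑ i, c i * g i) * ∑ i, c i)
        + ∑ i, ∑ j, (c i * g i) * (c j * g j) * Real.exp (v i ⬝ᵥ v j) := by
    have h2 : 2 * ((∑ i, c i * g i) * ∑ i, c i)
        = (∑ i, c i * g i) * (∑ i, c i) + (∑ i, c i) * ∑ i, c i * g i := by ring
    rw [h2, sq]
    simp only [Finset.sum_mul_sum, ← Finset.sum_add_distrib, ← Finset.sum_sub_distrib]
    refine Finset.sum_congr rfl fun i _ => Finset.sum_congr rfl fun j _ => ?_
    ring
  simp only [hG]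
  change 0 ≤ ∑ i, ∑ j, c i * c j * ((1 - g i) + (1 - g j) - (1 - g i * g j * Real.exp (v i ⬝ᵥ v j)))
  rw [hexp]
  nlinarith [sq_nonneg (∑ i, c i - ∑ i, c i * g i)]

theorem posSemidef_norm_add_norm_sub_dist (x : ι → EuclideanSpace ℝ κ) :
    (Matrix.of fun i j => ‖x i‖ + ‖x j‖ - dist (x i) (x j)).PosSemidef := by
  refine Matrix.PosSemidef.of_dotProduct_mulVec_nonneg ?_ fun c => ?_
  · ext i j
    simp [dist_comm, add_comm]
  · set J := ∫ u : ℝ, (1 - Real.exp (-u ^ 2)) / u ^ 2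
    refine nonneg_of_mul_nonneg_left ?_ integral_one_sub_exp_neg_sq_div_sq_pos
    have hI := integrable_one_sub_exp_neg_mul_sq_div_sq
    have hE : ∀ i j, (‖x i‖ + ‖x j‖ - dist (x i) (x j)) * J
        = ∫ u : ℝ, ((1 - Real.exp (-(‖x i‖ * u) ^ 2)) / u ^ 2
          + (1 - Real.exp (-(‖x j‖ * u) ^ 2)) / u ^ 2
          - (1 - Real.exp (-(dist (x i) (x j) * u) ^ 2)) / u ^ 2) := by
      intro i j
      rw [MeasureTheory.integral_sub (by exact (hI _).add (hI _)) (hI _),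
        MeasureTheory.integral_add (hI _) (hI _),
        integral_one_sub_exp_neg_mul_sq_div_sq (norm_nonneg _),
        integral_one_sub_exp_neg_mul_sq_div_sq (norm_nonneg _),
        integral_one_sub_exp_neg_mul_sq_div_sq dist_nonneg]
      ring
    have hQ : star c ⬝ᵥ (Matrix.of fun i j => ‖x i‖ + ‖x j‖ - dist (x i) (x j)) *ᵥ c * J
        = ∫ u : ℝ, ∑ i, ∑ j, c i * c j * ((1 - Real.exp (-(‖x i‖ * u) ^ 2)) / u ^ 2
          + (1 - Real.exp (-(‖x j‖ * u) ^ 2)) / u ^ 2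
          - (1 - Real.exp (-(dist (x i) (x j) * u) ^ 2)) / u ^ 2) := by
      have hI3 : ∀ i j, MeasureTheory.Integrable fun u : ℝ =>
          c i * c j * ((1 - Real.exp (-(‖x i‖ * u) ^ 2)) / u ^ 2
            + (1 - Real.exp (-(‖x j‖ * u) ^ 2)) / u ^ 2
            - (1 - Real.exp (-(dist (x i) (x j) * u) ^ 2)) / u ^ 2) := fun i j =>
        (((hI ‖x i‖).add (hI ‖x j‖)).sub (hI (dist (x i) (x j)))).const_mul (c i * c j)
      rw [MeasureTheory.integral_finsetSum _ fun i _ =>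
        MeasureTheory.integrable_finsetSum _ fun j _ => hI3 i j]
      simp only [dotProduct, mulVec, Finset.mul_sum, Finset.sum_mul]
      refine Finset.sum_congr rfl fun i _ => ?_
      rw [MeasureTheory.integral_finsetSum _ fun j _ => hI3 i j]
      refine Finset.sum_congr rfl fun j _ => ?_
      rw [MeasureTheory.integral_const_mul, ← hE]
      simp only [star_trivial, of_apply]
      ring
    rw [hQ]
    refine MeasureTheory.integral_nonneg fun u => ?_
    have := div_nonneg (recentred_gaussian_kernel_nonneg x c u) (sq_nonneg u)
    simpa only [Pi.zero_apply, Finset.sum_div, mul_div_assoc, add_div, sub_div] using this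

theorem posDef_exp_neg_dist {x : ι → EuclideanSpace ℝ κ} (hx : Function.Injective x) :
    (Matrix.of fun i j => Real.exp (-dist (x i) (x j))).PosDef := by
  classical
  obtain ⟨V, hV⟩ : ∃ V : Matrix ι ι ℝ,
      (Matrix.of fun i j => ‖x i‖ + ‖x j‖ - dist (x i) (x j)) = Vᴴ * V := by
    open scoped MatrixOrder in
    obtain ⟨V, hV⟩ := CStarAlgebra.nonneg_iff_eq_star_mul_self.mp
      (posSemidef_norm_add_norm_sub_dist x).nonneg
    exact ⟨V, hV⟩
  have hVapp : ∀ i j, Vᵀ i ⬝ᵥ Vᵀ j = ‖x i‖ + ‖x j‖ - dist (x i) (x j) := fun i j => by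
    simpa [Matrix.mul_apply, dotProduct] using (congrFun (congrFun hV i) j).symm
  have hinj : Function.Injective fun i => Vᵀ i := by
    intro i j hij
    have h1 := hVapp i j
    have h2 := hVapp j j
    dsimp only at hij
    rw [hij, h2, dist_self] at h1
    have h3 := hVapp i i
    rw [hij, h2, dist_self, dist_self] at h3
    exact hx (dist_eq_zero.mp (by linarith))
  refine Matrix.PosDef.of_dotProduct_mulVec_pos ?_ fun c hc => ?_
  · ext i j
    simp [dist_comm]
  · have hd : (fun i => c i * Real.exp (-‖x i‖)) ≠ 0 := fun h0 => hc <| funext fun i =>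
      (mul_eq_zero.mp (congrFun h0 i)).resolve_right (Real.exp_ne_zero _)
    have hpos := exp_dotProduct_kernel_pos hinj hd
    simp only [hVapp] at hpos
    refine hpos.trans_eq ?_
    simp only [dotProduct, mulVec, Finset.mul_sum, star_trivial, of_apply]
    refine Finset.sum_congr rfl fun i _ => Finset.sum_congr rfl fun j _ => ?_
    rw [show -dist (x i) (x j)
      = -‖x i‖ + -‖x j‖ + (‖x i‖ + ‖x j‖ - dist (x i) (x j)) by ring, Real.exp_add, Real.exp_add]
    ring

end ExpDist

section FromBlocks

variable {m n R : Type*} [Fintype m] [Fintype n] [DecidableEq m] [DecidableEq n] [CommRing R]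

theorem isUnit_det_schur_of_fromBlocks {A : Matrix m m R} {B : Matrix m n R} {C : Matrix n m R}
    {D : Matrix n n R} (hA : IsUnit A.det) (h : IsUnit (fromBlocks A B C D).det) :
    IsUnit (D - C * A⁻¹ * B).det := by
  let _ := invertibleOfIsUnitDet A hA
  rw [det_fromBlocks₁₁, invOf_eq_nonsing_inv] at h
  exact isUnit_of_mul_isUnit_right h

theorem inv_fromBlocks_mulVec_inl {A : Matrix m m R} {B : Matrix m n R} {C : Matrix n m R}
    {D : Matrix n n R} (hD : IsUnit D.det) (h : IsUnit (fromBlocks A B C D).det)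
    (hS : IsUnit (A - B * D⁻¹ * C).det) (b : m ⊕ n → R) :
    ((fromBlocks A B C D)⁻¹ *ᵥ b) ∘ Sum.inl
      = (A - B * D⁻¹ * C)⁻¹ *ᵥ (b ∘ Sum.inl - B *ᵥ (D⁻¹ *ᵥ (b ∘ Sum.inr))) := by
  set w := (fromBlocks A B C D)⁻¹ *ᵥ b with hw
  have hb : fromBlocks A B C D *ᵥ w = b := by
    rw [hw, mulVec_mulVec, mul_nonsing_inv _ h, one_mulVec]
  rw [fromBlocks_mulVec] at hb
  have key : (A - B * D⁻¹ * C) *ᵥ (w ∘ Sum.inl)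
      = b ∘ Sum.inl - B *ᵥ (D⁻¹ *ᵥ (b ∘ Sum.inr)) := by
    rw [← hb, Sum.elim_comp_inl, Sum.elim_comp_inr, mulVec_add, mulVec_mulVec _ D⁻¹ D,
      nonsing_inv_mul _ hD, one_mulVec, mulVec_add, sub_mulVec, mulVec_mulVec, mulVec_mulVec,
      Matrix.mul_assoc]
    abel
  rw [← key, mulVec_mulVec, nonsing_inv_mul _ hS, one_mulVec]

theorem inv_fromBlocks_mulVec_inr {A : Matrix m m R} {B : Matrix m n R} {C : Matrix n m R}
    {D : Matrix n n R} (hA : IsUnit A.det) (h : IsUnit (fromBlocks A B C D).det)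
    (hS : IsUnit (D - C * A⁻¹ * B).det) (b : m ⊕ n → R) :
    ((fromBlocks A B C D)⁻¹ *ᵥ b) ∘ Sum.inr
      = (D - C * A⁻¹ * B)⁻¹ *ᵥ (b ∘ Sum.inr - C *ᵥ (A⁻¹ *ᵥ (b ∘ Sum.inl))) := by
  set w := (fromBlocks A B C D)⁻¹ *ᵥ b with hw
  have hb : fromBlocks A B C D *ᵥ w = b := by
    rw [hw, mulVec_mulVec, mul_nonsing_inv _ h, one_mulVec]
  rw [fromBlocks_mulVec] at hb
  have key : (D - C * A⁻¹ * B) *ᵥ (w ∘ Sum.inr)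
      = b ∘ Sum.inr - C *ᵥ (A⁻¹ *ᵥ (b ∘ Sum.inl)) := by
    rw [← hb, Sum.elim_comp_inl, Sum.elim_comp_inr, mulVec_add, mulVec_mulVec _ A⁻¹ A,
      nonsing_inv_mul _ hA, one_mulVec, mulVec_add, sub_mulVec, mulVec_mulVec, mulVec_mulVec,
      Matrix.mul_assoc]
    abel
  rw [← key, mulVec_mulVec, nonsing_inv_mul _ hS, one_mulVec]

end FromBlocks

/-- Let X be a finite set of distinct points in ℝⁿ and Y ⊂ X a nonempty
proper subset, with the points of Y (family `y`) first and those of Ȳ = X∖Y (family `z`)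
second, giving ζ_X = [[ζ_Y, ζ_{Y,Ȳ}], [ζ_{Y,Ȳ}ᵀ, ζ_Ȳ]]. Then both Schur complements
ζ_X/ζ_Ȳ = ζ_Y − ζ_{Y,Ȳ}ζ_Ȳ⁻¹ζ_{Y,Ȳ}ᵀ and ζ_X/ζ_Y = ζ_Ȳ − ζ_{Y,Ȳ}ᵀζ_Y⁻¹ζ_{Y,Ȳ} are
invertible, and the restrictions of w_X satisfy
w_X|_Y = (ζ_X/ζ_Ȳ)⁻¹(𝟙_Y − ζ_{Y,Ȳ}·w_Ȳ) and w_X|_Ȳ = (ζ_X/ζ_Y)⁻¹(𝟙_Ȳ − ζ_{Y,Ȳ}ᵀ·w_Y). -/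
theorem weighting_vector_restriction {n p q : ℕ} (hp : 0 < p) (hq : 0 < q)
    (y : Fin p → EuclideanSpace ℝ (Fin n)) (z : Fin q → EuclideanSpace ℝ (Fin n))
    (hinj : Function.Injective (Sum.elim y z : Fin p ⊕ Fin q → EuclideanSpace ℝ (Fin n))) :
    let A : Matrix (Fin p) (Fin p) ℝ := Matrix.of fun i j => Real.exp (-dist (y i) (y j))
    let B : Matrix (Fin p) (Fin q) ℝ := Matrix.of fun i j => Real.exp (-dist (y i) (z j))
    let D : Matrix (Fin q) (Fin q) ℝ := Matrix.of fun i j => Real.exp (-dist (z i) (z j))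
    let S₁ : Matrix (Fin p) (Fin p) ℝ := A - B * D⁻¹ * Bᵀ
    let S₂ : Matrix (Fin q) (Fin q) ℝ := D - Bᵀ * A⁻¹ * B
    let ζX : Matrix (Fin p ⊕ Fin q) (Fin p ⊕ Fin q) ℝ := Matrix.fromBlocks A B Bᵀ D
    let wX : Fin p ⊕ Fin q → ℝ := ζX⁻¹ *ᵥ fun _ => (1 : ℝ)
    let wY : Fin p → ℝ := A⁻¹ *ᵥ fun _ => (1 : ℝ)
    let wYbar : Fin q → ℝ := D⁻¹ *ᵥ fun _ => (1 : ℝ)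
    IsUnit S₁.det ∧ IsUnit S₂.det ∧
    (fun i => wX (Sum.inl i)) = S₁⁻¹ *ᵥ ((fun _ => (1 : ℝ)) - B *ᵥ wYbar) ∧
    (fun j => wX (Sum.inr j)) = S₂⁻¹ *ᵥ ((fun _ => (1 : ℝ)) - Bᵀ *ᵥ wY) := by
  intro A B D S₁ S₂ ζX wX wY wYbar
  have hA : IsUnit A.det :=
    (posDef_exp_neg_dist (hinj.comp Sum.inl_injective)).det_pos.ne'.isUnit
  have hD : IsUnit D.det :=
    (posDef_exp_neg_dist (hinj.comp Sum.inr_injective)).det_pos.ne'.isUnit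
  have hζ : ζX = Matrix.of fun i j => Real.exp (-dist (Sum.elim y z i) (Sum.elim y z j)) := by
    ext (i | i) (j | j) <;> simp [ζX, A, B, D, dist_comm]
  have hX : IsUnit ζX.det := by
    rw [hζ]
    exact (posDef_exp_neg_dist hinj).det_pos.ne'.isUnit
  have hX' : IsUnit (fromBlocks D Bᵀ B A).det := by
    rwa [← fromBlocks_submatrix_sum_swap_sum_swap, ← Equiv.sumComm_apply, det_submatrix_equiv_self]
  have hS₁ : IsUnit S₁.det := isUnit_det_schur_of_fromBlocks hD hX'
  have hS₂ : IsUnit S₂.det := isUnit_det_schur_of_fromBlocks hA hX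
  exact ⟨hS₁, hS₂, inv_fromBlocks_mulVec_inl hD hX hS₁ _, inv_fromBlocks_mulVec_inr hA hX hS₂ _⟩
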